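/- arXiv:2412.19936 — 4 statements merged into one kernel-verified Lean document; each statement's English description precedes it below -/
import Mathlib

section
/- Let (C, 𝓕, W) be a category of fibrant objects. Then the localization C[W⁻¹] of C at the class W of weak equivalences has finite products, and the localization functor C → C[W⁻¹] preserves finite products. -/
open CategoryTheory Limits

universe v u v' u'

/-- A *category of fibrant objects*: a category `C` with a terminal object, together with two
classes of morphisms (fibrations `Fib` and weak equivalences `Weq`), each containing all
identities and closed under composition, satisfying the axioms (F1)-(F3), (W1), (W2),
(FW1), (FW2) of Brown.  (Binary products exist in any category of fibrant objects by (F2) and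
(F3); we record this as a field so that axiom (FW2) can be stated.) -/
structure CategoryOfFibrantObjects (C : Type u) [Category.{v} C] where
  /-- the class of fibrations -/
  Fib : CategoryTheory.MorphismProperty C
  /-- the class of weak equivalences -/
  Weq : CategoryTheory.MorphismProperty C
  fib_id : ∀ X : C, Fib (𝟙 X)
  fib_comp : ∀ {X Y Z : C} (f : X ⟶ Y) (g : Y ⟶ Z), Fib f → Fib g → Fib (f ≫ g)
  weq_id : ∀ X : C, Weq (𝟙 X)
  weq_comp : ∀ {X Y Z : C} (f : X ⟶ Y) (g : Y ⟶ Z), Weq f → Weq g → Weq (f ≫ g)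
  [hasTerminal : HasTerminal C]
  /-- (F1) isomorphisms are fibrations -/
  F1 : ∀ {X Y : C} (f : X ⟶ Y), IsIso f → Fib f
  /-- (F2) pullbacks of fibrations exist ... -/
  F2_exists : ∀ {X Y Z : C} (f : X ⟶ Z) (g : Y ⟶ Z), Fib f →
    ∃ (P : C) (fst : P ⟶ X) (snd : P ⟶ Y), IsPullback fst snd f g
  /-- (F2) ... and are fibrations -/
  F2_stable : ∀ {P X Y Z : C} (fst : P ⟶ X) (snd : P ⟶ Y) (f : X ⟶ Z) (g : Y ⟶ Z),
    Fib f → IsPullback fst snd f g → Fib snd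
  /-- (F3) every morphism to the terminal object is a fibration -/
  F3 : ∀ X : C, Fib (terminal.from X)
  /-- (W1) isomorphisms are weak equivalences -/
  W1 : ∀ {X Y : C} (f : X ⟶ Y), IsIso f → Weq f
  /-- (W2) two-out-of-three (the composition case is `weq_comp`) -/
  W2_right : ∀ {X Y Z : C} (f : X ⟶ Y) (g : Y ⟶ Z), Weq f → Weq (f ≫ g) → Weq g
  W2_left : ∀ {X Y Z : C} (f : X ⟶ Y) (g : Y ⟶ Z), Weq g → Weq (f ≫ g) → Weq f
  /-- (FW1) pullbacks of trivial fibrations are trivial fibrations -/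
  FW1 : ∀ {P X Y Z : C} (fst : P ⟶ X) (snd : P ⟶ Y) (f : X ⟶ Z) (g : Y ⟶ Z),
    Fib f → Weq f → IsPullback fst snd f g → Fib snd ∧ Weq snd
  [hasBinaryProducts : HasBinaryProducts C]
  /-- (FW2) path objects: the diagonal factors as a weak equivalence followed by a fibration -/
  FW2 : ∀ B : C, ∃ (PB : C) (s : B ⟶ PB) (d : PB ⟶ B ⨯ B),
    Weq s ∧ Fib d ∧ s ≫ d = prod.lift (𝟙 B) (𝟙 B)

namespace CategoryOfFibrantObjects

variable {C : Type u} [Category.{v} C] (S : CategoryOfFibrantObjects C)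

lemma weq_isStableUnderProductsOfShape_pempty :
    S.Weq.IsStableUnderProductsOfShape PEmpty.{1} where
  condition X₁ X₂ c₁ c₂ hc₁ hc₂ f hf α hα := by
    refine S.W1 _ ⟨hc₁.lift ⟨c₂.pt, ⟨fun j => j.as.elim, fun j => j.as.elim⟩⟩, ?_, ?_⟩
    · exact hc₁.hom_ext fun j => j.as.elim
    · exact hc₂.hom_ext fun j => j.as.elim

variable [HasTerminal C] [HasBinaryProducts C]

lemma fib_fst (X Y : C) : S.Fib (prod.fst : X ⨯ Y ⟶ X) :=
  S.F2_stable _ _ _ _ (S.F3 Y) (IsPullback.of_hasBinaryProduct' X Y).flip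

lemma fib_snd (X Y : C) : S.Fib (prod.snd : X ⨯ Y ⟶ Y) :=
  S.F2_stable _ _ _ _ (S.F3 X) (IsPullback.of_hasBinaryProduct' X Y)

/-- Brown's factorization lemma for weak equivalences: a weak equivalence is a section of a
trivial fibration followed by a trivial fibration. -/
lemma exists_factorization_of_weq {X Y : C} (f : X ⟶ Y) (hf : S.Weq f) :
    ∃ (P : C) (s : X ⟶ P) (q : P ⟶ X) (p : P ⟶ Y),
      s ≫ q = 𝟙 X ∧ s ≫ p = f ∧ (S.Fib q ∧ S.Weq q) ∧ S.Fib p ∧ S.Weq p := by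
  obtain ⟨PY, t, d, ht, hd, htd⟩ := S.FW2 Y
  obtain ⟨P, a, e, sq⟩ := S.F2_exists d (prod.map f (𝟙 Y)) hd
  have he : S.Fib e := S.F2_stable _ _ _ _ hd sq
  have hd₀ : S.Weq (d ≫ prod.fst) :=
    S.W2_right t _ ht (by rw [reassoc_of% htd, prod.lift_fst]; exact S.weq_id Y)
  have hq : S.Fib (e ≫ prod.fst) ∧ S.Weq (e ≫ prod.fst) :=
    S.FW1 _ _ _ _ (S.fib_comp _ _ hd (S.fib_fst Y Y)) hd₀
      (sq.paste_vert (IsPullback.of_prod_fst_with_id f Y).flip)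
  have w : (f ≫ t) ≫ d = prod.lift (𝟙 X) f ≫ prod.map f (𝟙 Y) := by
    rw [Category.assoc, htd]
    ext <;> simp
  have hsq : sq.lift _ _ w ≫ e ≫ prod.fst = 𝟙 X := by simp [prod.lift_fst]
  have hsp : sq.lift _ _ w ≫ e ≫ prod.snd = f := by simp [prod.lift_snd]
  have hs : S.Weq (sq.lift _ _ w) := S.W2_left _ _ hq.2 (by rw [hsq]; exact S.weq_id X)
  exact ⟨P, sq.lift _ _ w, e ≫ prod.fst, e ≫ prod.snd, hsq, hsp, hq,
    S.fib_comp _ _ he (S.fib_snd X Y), S.W2_right _ _ hs (by rwa [hsp])⟩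

lemma weq_prod_map_id_right {X Y : C} (f : X ⟶ Y) (hf : S.Weq f) (Z : C) :
    S.Weq (prod.map f (𝟙 Z)) := by
  obtain ⟨P, s, q, p, hsq, hsp, hq, hp⟩ := S.exists_factorization_of_weq f hf
  have hq' := S.FW1 _ _ _ _ hq.1 hq.2 (IsPullback.of_prod_fst_with_id q Z)
  have hp' := S.FW1 _ _ _ _ hp.1 hp.2 (IsPullback.of_prod_fst_with_id p Z)
  have hs' : S.Weq (prod.map s (𝟙 Z)) := S.W2_left _ _ hq'.2 (by
    rw [prod.map_map, hsq, Category.comp_id, prod.map_id_id]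
    exact S.weq_id _)
  have h := S.weq_comp _ _ hs' hp'.2
  rwa [prod.map_map, hsp, Category.comp_id] at h

lemma weq_prod_map {X Y X' Y' : C} (f : X ⟶ Y) (g : X' ⟶ Y') (hf : S.Weq f) (hg : S.Weq g) :
    S.Weq (prod.map f g) := by
  have hg' : S.Weq (prod.map (𝟙 Y) g) := by
    have h := S.weq_comp _ _ (S.weq_comp _ _ (S.W1 (prod.braiding Y X').hom inferInstance)
      (S.weq_prod_map_id_right g hg Y)) (S.W1 (prod.braiding Y' Y).hom inferInstance)
    convert h using 1
    ext <;> simp [prod.lift_fst, prod.lift_snd]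
  have h := S.weq_comp _ _ (S.weq_prod_map_id_right f hf X') hg'
  rwa [prod.map_map, Category.comp_id, Category.id_comp] at h

lemma weq_isStableUnderProductsOfShape_walkingPair :
    S.Weq.IsStableUnderProductsOfShape WalkingPair where
  condition X₁ X₂ c₁ c₂ hc₁ hc₂ f hf α hα := by
    let e₁ := IsLimit.conePointsIsoOfNatIso hc₁ (limit.isLimit _) (diagramIsoPair X₁)
    let e₂ := IsLimit.conePointsIsoOfNatIso (limit.isLimit _) hc₂ (diagramIsoPair X₂).symm
    have h : α = e₁.hom ≫ prod.map (f.app ⟨.left⟩) (f.app ⟨.right⟩) ≫ e₂.hom := by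
      refine hc₂.hom_ext ?_
      rintro ⟨_ | _⟩
      · have : e₁.hom ≫ prod.fst = c₁.π.app ⟨.left⟩ :=
          (IsLimit.map_π _ _ _ _).trans (Category.comp_id _)
        simp [e₂, hα, reassoc_of% this]
      · have : e₁.hom ≫ prod.snd = c₁.π.app ⟨.right⟩ :=
          (IsLimit.map_π _ _ _ _).trans (Category.comp_id _)
        simp [e₂, hα, reassoc_of% this]
    rw [h]
    exact S.weq_comp _ _ (S.W1 _ inferInstance)
      (S.weq_comp _ _ (S.weq_prod_map _ _ (hf _) (hf _)) (S.W1 _ inferInstance))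

end CategoryOfFibrantObjects

theorem stmt0 {C : Type u} [Category.{v} C] (S : CategoryOfFibrantObjects C)
    {D : Type u'} [Category.{v'} D] (L : C ⥤ D) [L.IsLocalization S.Weq] :
    HasFiniteProducts D ∧ Nonempty (PreservesFiniteProducts L) := by
  have := S.hasTerminal
  have := S.hasBinaryProducts
  have : S.Weq.ContainsIdentities := ⟨S.weq_id⟩
  have := S.weq_isStableUnderProductsOfShape_pempty
  have := S.weq_isStableUnderProductsOfShape_walkingPair
  have : HasTerminal D := Localization.hasProductsOfShape L S.Weq PEmpty
  have : HasBinaryProducts D := Localization.hasProductsOfShape L S.Weq WalkingPair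
  have := Localization.preservesProductsOfShape L S.Weq PEmpty
  have := Localization.preservesProductsOfShape L S.Weq WalkingPair
  have : HasFiniteProducts C := hasFiniteProducts_of_has_binary_and_terminal
  exact ⟨hasFiniteProducts_of_has_binary_and_terminal,
    ⟨.of_preserves_binary_and_terminal L⟩⟩
end

section
/- Let (C, 𝓕, W) be a category of fibrant objects. If f : A → A' and g : B → B' are weak equivalences, then the product morphism f × g : A × B → A' × B' is a weak equivalence. -/
open CategoryTheory Limits

universe v u v' u'

namespace CategoryOfFibrantObjects

/-- The square expressing `prod.map f (𝟙 B)` as the base change of `f` along `prod.fst`. -/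
lemma isPullback_prod_fst {C : Type u} [Category.{v} C] [HasBinaryProducts C]
    {A A' : C} (f : A ⟶ A') (B : C) :
    IsPullback prod.fst (prod.map f (𝟙 B)) f prod.fst := by
  refine ⟨⟨by simp⟩, ⟨PullbackCone.IsLimit.mk _
    (fun s => prod.lift s.fst (s.snd ≫ prod.snd)) ?_ ?_ ?_⟩⟩
  · intro s
    rw [prod.lift_fst]
  · intro s
    ext
    · rw [Category.assoc, prod.map_fst, prod.lift_fst_assoc, s.condition]
    · rw [Category.assoc, prod.map_snd, Category.comp_id, prod.lift_snd]
  · intro s m h₁ h₂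
    ext
    · rw [h₁, prod.lift_fst]
    · simpa [prod.lift_snd] using h₂ =≫ prod.snd

variable {C : Type u} [Category.{v} C] (S : CategoryOfFibrantObjects C)

lemma fib_snd_s1 [HasBinaryProducts C] (A B : C) : S.Fib (prod.snd : A ⨯ B ⟶ B) := by
  have := S.hasTerminal
  exact S.F2_stable _ _ _ _ (S.F3 A) (IsPullback.of_is_product
    (prodIsProd A B) terminalIsTerminal)

lemma fib_fst_s1 [HasBinaryProducts C] (A B : C) : S.Fib (prod.fst : A ⨯ B ⟶ A) := by
  have := S.hasTerminal
  exact S.F2_stable _ _ _ _ (S.F3 B) (IsPullback.of_is_product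
    (prodIsProd A B) terminalIsTerminal).flip

/-- Brown's factorization: a weak equivalence is a section of a trivial fibration followed by a
trivial fibration. -/
lemma exists_section_comp_trivialFibration {A B : C} (f : A ⟶ B) (hf : S.Weq f) :
    ∃ (P : C) (i : A ⟶ P) (r : P ⟶ A) (p : P ⟶ B), i ≫ r = 𝟙 A ∧ i ≫ p = f ∧
      S.Fib r ∧ S.Weq r ∧ S.Fib p ∧ S.Weq p := by
  have := S.hasBinaryProducts
  obtain ⟨PB, s, d, hs, hd, hsd⟩ := S.FW2 B
  obtain ⟨P, t, q, hP⟩ := S.F2_exists d (prod.map f (𝟙 B)) hd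
  have hq : S.Fib q := S.F2_stable _ _ _ _ hd hP
  have hd₁ : S.Weq (d ≫ prod.fst) := by
    refine S.W2_right s _ hs ?_
    rw [← Category.assoc, hsd, prod.lift_fst]
    exact S.weq_id B
  have hr := S.FW1 _ _ _ _ (S.fib_comp _ _ hd (S.fib_fst_s1 B B)) hd₁
    (hP.paste_vert (isPullback_prod_fst f B).flip)
  obtain ⟨i, -, hi⟩ := hP.exists_lift (f ≫ s) (prod.lift (𝟙 A) f) (by simp [hsd])
  have hir : i ≫ q ≫ prod.fst = 𝟙 A := by
    rw [← Category.assoc, hi, prod.lift_fst]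
  have hip : i ≫ q ≫ prod.snd = f := by
    rw [← Category.assoc, hi, prod.lift_snd]
  have hi' : S.Weq i := S.W2_left _ _ hr.2 (hir ▸ S.weq_id A)
  exact ⟨P, i, q ≫ prod.fst, q ≫ prod.snd, hir, hip, hr.1, hr.2,
    S.fib_comp _ _ hq (S.fib_snd_s1 A B), S.W2_right _ _ hi' (hip.symm ▸ hf)⟩

/-- Weak equivalences are stable under taking the product with an object. -/
lemma weq_prod_map_id [HasBinaryProducts C] {A A' : C} (f : A ⟶ A') (hf : S.Weq f) (B : C) :
    S.Weq (prod.map f (𝟙 B)) := by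
  have trivialFibration {X Y : C} (p : X ⟶ Y) (hp : S.Fib p) (hp' : S.Weq p) :
      S.Weq (prod.map p (𝟙 B)) :=
    (S.FW1 _ _ _ _ hp hp' (isPullback_prod_fst p B)).2
  obtain ⟨P, i, r, p, hir, rfl, hr, hr', hp, hp'⟩ := S.exists_section_comp_trivialFibration f hf
  have hi : S.Weq (prod.map i (𝟙 B)) := by
    refine S.W2_left _ _ (trivialFibration r hr hr') ?_
    rw [prod.map_map, hir, Category.comp_id, prod.map_id_id]
    exact S.weq_id _
  simpa using S.weq_comp _ _ hi (trivialFibration p hp hp')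

end CategoryOfFibrantObjects

theorem stmt1 {C : Type u} [Category.{v} C] (S : CategoryOfFibrantObjects C)
    {A A' B B' : C} (f : A ⟶ A') (g : B ⟶ B') (hf : S.Weq f) (hg : S.Weq g) :
    letI := S.hasBinaryProducts
    S.Weq (Limits.prod.map f g) := by
  have := S.hasBinaryProducts
  have hg' : S.Weq (prod.map (𝟙 A') g) := by
    have h := S.weq_comp _ _ (S.W1 (prod.braiding A' B).hom inferInstance)
      (S.weq_comp _ _ (S.weq_prod_map_id g hg A') (S.W1 (prod.braiding B' A').hom inferInstance))
    convert h using 1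
    ext <;> simp [prod.lift_fst, prod.lift_fst_assoc, prod.lift_snd]
  simpa using S.weq_comp _ _ (S.weq_prod_map_id f hf B) hg'
end

section
/- Let ℓ be an integral domain and let α : Ω₁ → Ω₀ be any homomorphism of ℓ-algebras. Then either α ∘ β = 0 or α ∘ β̃ = 0, where β(p) = (p, 0) and β̃(p) = (0, p). More precisely, α(t²−t, 0)·α(0, t²−t) = 0 in the domain ℓ[t], and if α(t²−t, 0) = 0 then α(β(p)) = 0 for every p ∈ Ω₀ (symmetrically for β̃). -/
open Polynomial

variable (ℓ : Type) [CommRing ℓ]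



/-- The non-unital `ℓ`-algebra `Ω₀ := (t²−t)·ℓ[t] ⊆ ℓ[t]`. -/
def Omega0 : NonUnitalSubalgebra ℓ (Polynomial ℓ) where
  carrier := {p | ∃ q : Polynomial ℓ, p = (X ^ 2 - X) * q}
  add_mem' := by
    rintro p p' ⟨q, rfl⟩ ⟨q', rfl⟩
    exact ⟨q + q', by ring⟩
  zero_mem' := ⟨0, by ring⟩
  mul_mem' := by
    rintro p p' ⟨q, rfl⟩ ⟨q', rfl⟩
    exact ⟨q * (X ^ 2 - X) * q', by ring⟩
  smul_mem' := by
    rintro c p ⟨q, rfl⟩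
    exact ⟨c • q, by rw [mul_smul_comm]⟩

variable {ℓ} in
theorem Omega0.eval_eq_zero {p : Polynomial ℓ} (hp : p ∈ Omega0 ℓ) :
    p.eval 0 = 0 ∧ p.eval 1 = 0 := by
  obtain ⟨q, rfl⟩ := hp
  constructor <;> simp

/-- The non-unital `ℓ`-algebra
`Ω₁ := {(p,q) ∈ ℓ[t] × ℓ[t] : p(1) = q(0), p(0) = q(1) = 0}`. -/
def Omega1 : NonUnitalSubalgebra ℓ (Polynomial ℓ × Polynomial ℓ) where
  carrier := {x | x.1.eval 1 = x.2.eval 0 ∧ x.1.eval 0 = 0 ∧ x.2.eval 1 = 0}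
  add_mem' := by
    rintro x y ⟨h1, h2, h3⟩ ⟨h1', h2', h3'⟩
    refine ⟨?_, ?_, ?_⟩ <;> simp_all
  zero_mem' := by simp
  mul_mem' := by
    rintro x y ⟨h1, h2, h3⟩ ⟨h1', h2', h3'⟩
    refine ⟨?_, ?_, ?_⟩ <;> simp_all
  smul_mem' := by
    rintro c x ⟨h1, h2, h3⟩
    refine ⟨?_, ?_, ?_⟩ <;> simp_all

/-- The homomorphism `β : Ω₀ → Ω₁`, `β(p) = (p, 0)`. -/
noncomputable def betaMap : Omega0 ℓ →ₙₐ[ℓ] Omega1 ℓ where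
  toFun p := ⟨((p : Polynomial ℓ), 0),
    by
      obtain ⟨h0, h1⟩ := Omega0.eval_eq_zero p.2
      exact ⟨by simp [h1], by simp [h0], by simp⟩⟩
  map_add' p q := by ext : 1 <;> simp
  map_mul' p q := by ext : 1 <;> simp
  map_zero' := by ext : 1 <;> simp
  map_smul' c p := by ext : 1 <;> simp

/-- The homomorphism `β̃ : Ω₀ → Ω₁`, `β̃(p) = (0, p)`. -/
noncomputable def betaTildeMap : Omega0 ℓ →ₙₐ[ℓ] Omega1 ℓ where
  toFun p := ⟨((0 : Polynomial ℓ), (p : Polynomial ℓ)),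
    by
      obtain ⟨h0, h1⟩ := Omega0.eval_eq_zero p.2
      exact ⟨by simp [h0], by simp, by simp [h1]⟩⟩
  map_add' p q := by ext : 1 <;> simp
  map_mul' p q := by ext : 1 <;> simp
  map_zero' := by ext : 1 <;> simp
  map_smul' c p := by ext : 1 <;> simp

/-- The element `t² − t` of `Ω₀`. -/
noncomputable def tSqSubT : Omega0 ℓ := ⟨X ^ 2 - X, 1, by ring⟩

variable {ℓ} in
/-- A homomorphism out of `Ω₀` into an algebra without zero divisors vanishes if it kills `t² − t`, because
`p ^ 2` is a multiple of `t² − t` in `Ω₀` for every `p ∈ Ω₀`. -/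
theorem Omega0.map_eq_zero_of_map_tSqSubT {A : Type*} [NonUnitalNonAssocSemiring A]
    [NoZeroDivisors A] [DistribMulAction ℓ A] (f : Omega0 ℓ →ₙₐ[ℓ] A)
    (hf : f (tSqSubT ℓ) = 0) (p : Omega0 ℓ) : f p = 0 := by
  obtain ⟨p, q, rfl⟩ := p
  have hsq : (⟨(X ^ 2 - X) * q, q, rfl⟩ : Omega0 ℓ) * ⟨(X ^ 2 - X) * q, q, rfl⟩ =
      tSqSubT ℓ * ⟨(X ^ 2 - X) * q ^ 2, q ^ 2, rfl⟩ := by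
    apply Subtype.ext
    change (X ^ 2 - X) * q * ((X ^ 2 - X) * q) = (X ^ 2 - X) * ((X ^ 2 - X) * q ^ 2)
    ring
  apply mul_self_eq_zero.mp
  rw [← map_mul, hsq, map_mul, hf, zero_mul]

variable {ℓ} in
theorem betaMap_mul_betaTildeMap (p q : Omega0 ℓ) : betaMap ℓ p * betaTildeMap ℓ q = 0 := by
  apply Subtype.ext
  change ((p : ℓ[X]), (0 : ℓ[X])) * ((0 : ℓ[X]), (q : ℓ[X])) = 0
  simp

/-- Let `ℓ` be an integral domain and let `α : Ω₁ → Ω₀` be any homomorphism of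
`ℓ`-algebras.  Then `α(t²−t, 0) · α(0, t²−t) = 0` in the domain `ℓ[t]`; if `α(t²−t, 0) = 0`
then `α ∘ β = 0`, and symmetrically if `α(0, t²−t) = 0` then `α ∘ β̃ = 0`; in particular,
either `α ∘ β = 0` or `α ∘ β̃ = 0`. -/
theorem stmt3 [IsDomain ℓ] (α : Omega1 ℓ →ₙₐ[ℓ] Omega0 ℓ) :
    ((α (betaMap ℓ (tSqSubT ℓ)) : Polynomial ℓ) *
        (α (betaTildeMap ℓ (tSqSubT ℓ)) : Polynomial ℓ) = 0) ∧
    ((α (betaMap ℓ (tSqSubT ℓ)) : Polynomial ℓ) = 0 →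
        ∀ p : Omega0 ℓ, α (betaMap ℓ p) = 0) ∧
    ((α (betaTildeMap ℓ (tSqSubT ℓ)) : Polynomial ℓ) = 0 →
        ∀ p : Omega0 ℓ, α (betaTildeMap ℓ p) = 0) ∧
    ((∀ p : Omega0 ℓ, α (betaMap ℓ p) = 0) ∨ (∀ p : Omega0 ℓ, α (betaTildeMap ℓ p) = 0)) := by
  have : NoZeroDivisors (Omega0 ℓ) :=
    Subtype.val_injective.noZeroDivisors _ rfl fun _ _ => rfl
  have hmul : (α (betaMap ℓ (tSqSubT ℓ)) : Polynomial ℓ) *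
      (α (betaTildeMap ℓ (tSqSubT ℓ)) : Polynomial ℓ) = 0 := by
    have h := map_mul α (betaMap ℓ (tSqSubT ℓ)) (betaTildeMap ℓ (tSqSubT ℓ))
    rw [betaMap_mul_betaTildeMap, map_zero] at h
    exact (congrArg Subtype.val h).symm
  have hβ : (α (betaMap ℓ (tSqSubT ℓ)) : Polynomial ℓ) = 0 →
      ∀ p : Omega0 ℓ, α (betaMap ℓ p) = 0 := fun h =>
    Omega0.map_eq_zero_of_map_tSqSubT (α.comp (betaMap ℓ)) (Subtype.ext h)
  have hβ' : (α (betaTildeMap ℓ (tSqSubT ℓ)) : Polynomial ℓ) = 0 →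
      ∀ p : Omega0 ℓ, α (betaTildeMap ℓ p) = 0 := fun h =>
    Omega0.map_eq_zero_of_map_tSqSubT (α.comp (betaTildeMap ℓ)) (Subtype.ext h)
  exact ⟨hmul, hβ, hβ', (mul_eq_zero.mp hmul).imp hβ hβ'⟩
end

section
/- The map H : Ω₀ → Ω₁[s] given by H(p) = (p(t(1−s)), p(1−s(1−t))) is a well-defined homomorphism of ℓ-algebras, and it is an elementary homotopy from β to β̃: evaluating s at 0 gives β and evaluating s at 1 gives β̃. In particular β and β̃ are polynomially homotopic. -/
open Polynomial

variable (ℓ : Type) [CommRing ℓ]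

section PolyNU
variable (B : Type) [NonUnitalRing B] [Module ℓ B] [IsScalarTower ℓ B B] [SMulCommClass ℓ B B]

/-- The algebra `B[t]` of polynomials with coefficients in the non-unital algebra `B`,
realized as the non-unital subalgebra of `(Unitization ℓ B)[X]` consisting of the polynomials
all of whose coefficients lie in `B` (i.e. have vanishing scalar part). -/
def polyNU : NonUnitalSubalgebra ℓ (Polynomial (Unitization ℓ B)) where
  carrier := {p | ∀ n, (p.coeff n).fst = 0}
  add_mem' := by
    intro p q hp hq n
    simp [hp n, hq n]
  zero_mem' := by intro n; simp
  mul_mem' := by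
    intro p q hp hq n
    rw [Polynomial.coeff_mul]
    rw [← Unitization.fstHom_apply ℓ B, map_sum]
    refine Finset.sum_eq_zero fun x _ => ?_
    simp [hp x.1]
  smul_mem' := by
    intro c p hp n
    simp [Polynomial.coeff_smul, hp n]

end PolyNU

section EvAt
variable {ℓ} {B : Type} [NonUnitalRing B] [Module ℓ B] [IsScalarTower ℓ B B] [SMulCommClass ℓ B B]

theorem fst_eval_polyNU (r : ℓ) (p : polyNU ℓ B) :
    (Polynomial.eval (algebraMap ℓ (Unitization ℓ B) r) (p : Polynomial (Unitization ℓ B))).fst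
      = 0 := by
  have h : ((p : Polynomial (Unitization ℓ B)).map
      (Unitization.fstHom ℓ B).toRingHom) = 0 := by
    ext n
    simpa using p.2 n
  have h2 : (Unitization.fstHom ℓ B).toRingHom
      (((p : Polynomial (Unitization ℓ B))).eval₂ (RingHom.id _)
        (algebraMap ℓ (Unitization ℓ B) r))
      = ((p : Polynomial (Unitization ℓ B))).eval₂
          ((Unitization.fstHom ℓ B).toRingHom.comp (RingHom.id _))
          ((Unitization.fstHom ℓ B).toRingHom (algebraMap ℓ (Unitization ℓ B) r)) :=
    Polynomial.hom_eval₂ _ _ _ _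
  rw [Polynomial.eval₂_eq_eval_map, Polynomial.eval₂_eq_eval_map, Polynomial.map_id,
    RingHom.comp_id, h] at h2
  simpa using h2

/-- Evaluation of a polynomial with coefficients in `B` at the scalar `r : ℓ`. -/
noncomputable def evAt (r : ℓ) : polyNU ℓ B →ₙₐ[ℓ] B where
  toFun p := (Polynomial.eval (algebraMap ℓ (Unitization ℓ B) r)
      (p : Polynomial (Unitization ℓ B))).snd
  map_add' p q := by simp
  map_smul' c p := by simp [Polynomial.eval_smul]
  map_zero' := by simp
  map_mul' p q := by
    have hc : ∀ k : Unitization ℓ B, Commute k (algebraMap ℓ (Unitization ℓ B) r) :=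
      fun k => (Algebra.commutes r k).symm
    have : Polynomial.eval (algebraMap ℓ (Unitization ℓ B) r)
        ((p : Polynomial (Unitization ℓ B)) * (q : Polynomial (Unitization ℓ B)))
        = Polynomial.eval (algebraMap ℓ (Unitization ℓ B) r) (p : Polynomial (Unitization ℓ B))
          * Polynomial.eval (algebraMap ℓ (Unitization ℓ B) r)
            (q : Polynomial (Unitization ℓ B)) :=
      Polynomial.eval₂_mul_noncomm (RingHom.id _) _
        (fun k => (Algebra.commutes r _).symm)
    simp only [NonUnitalSubalgebra.coe_mul, this, Unitization.snd_mul,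
      fst_eval_polyNU, zero_smul, zero_add]

end EvAt

section Homotopy
variable {ℓ}
variable {A B : Type} [NonUnitalRing A] [Module ℓ A] [IsScalarTower ℓ A A] [SMulCommClass ℓ A A]
  [NonUnitalRing B] [Module ℓ B] [IsScalarTower ℓ B B] [SMulCommClass ℓ B B]

/-- Two homomorphisms of non-unital `ℓ`-algebras are *elementarily (polynomially) homotopic*
if there is a homomorphism `H : A → B[t]` with `ev₀ ∘ H = f` and `ev₁ ∘ H = g`. -/
def ElemHomotopic (f g : A →ₙₐ[ℓ] B) : Prop :=
  ∃ H : A →ₙₐ[ℓ] polyNU ℓ B, (evAt 0).comp H = f ∧ (evAt 1).comp H = g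

/-- *Polynomial homotopy*: the equivalence relation generated by elementary homotopy. -/
def Homotopic (f g : A →ₙₐ[ℓ] B) : Prop :=
  Relation.EqvGen ElemHomotopic f g

end Homotopy

/-- A homomorphism of non-unital `ℓ`-algebras is a *polynomial homotopy equivalence* if it is
invertible up to polynomial homotopy. -/
def IsPHE {A B : Type}
    [NonUnitalRing A] [Module ℓ A] [IsScalarTower ℓ A A] [SMulCommClass ℓ A A]
    [NonUnitalRing B] [Module ℓ B] [IsScalarTower ℓ B B] [SMulCommClass ℓ B B]
    (f : A →ₙₐ[ℓ] B) : Prop :=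
  ∃ g : B →ₙₐ[ℓ] A, Homotopic (g.comp f) (NonUnitalAlgHom.id ℓ A) ∧
    Homotopic (f.comp g) (NonUnitalAlgHom.id ℓ B)



section CoefficientsInSubalgebra
variable {ℓ} {R : Type} [CommRing R] [Algebra ℓ R] (S : NonUnitalSubalgebra ℓ R)

/-- The homomorphism `S[s] → R[s]` induced by the inclusion of a non-unital subalgebra `S` of a
unital algebra `R`, extended to polynomials over the unitization of `S`. -/
noncomputable def unitizationPolyMap : Polynomial (Unitization ℓ S) →ₐ[ℓ] Polynomial R :=
  Polynomial.mapAlgHom (Unitization.lift (NonUnitalSubalgebraClass.subtype S))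

theorem coeff_unitizationPolyMap (q : Polynomial (Unitization ℓ S)) (n : ℕ) :
    (unitizationPolyMap S q).coeff n
      = algebraMap ℓ R (q.coeff n).fst + ((q.coeff n).snd : R) := by
  simp [unitizationPolyMap]

theorem coeff_unitizationPolyMap_polyNU (q : polyNU ℓ S) (n : ℕ) :
    (unitizationPolyMap S (q : Polynomial (Unitization ℓ S))).coeff n
      = (((q : Polynomial (Unitization ℓ S)).coeff n).snd : R) := by
  rw [coeff_unitizationPolyMap, q.2 n, map_zero, zero_add]

theorem unitizationPolyMap_injective_polyNU {q q' : polyNU ℓ S}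
    (h : unitizationPolyMap S (q : Polynomial (Unitization ℓ S)) = unitizationPolyMap S q') :
    q = q' := by
  refine Subtype.ext (Polynomial.ext fun n => Unitization.ext ?_ (Subtype.ext ?_))
  · rw [q.2 n, q'.2 n]
  · rw [← coeff_unitizationPolyMap_polyNU, ← coeff_unitizationPolyMap_polyNU, h]

theorem exists_polyNU_unitizationPolyMap_eq {q : Polynomial R} (hq : ∀ n, q.coeff n ∈ S) :
    ∃ q' : polyNU ℓ S, unitizationPolyMap S (q' : Polynomial (Unitization ℓ S)) = q := by
  have hc : ∀ n, (∑ i ∈ q.support, Polynomial.monomial i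
      (Unitization.inr ⟨q.coeff i, hq i⟩ : Unitization ℓ S)).coeff n
        = Unitization.inr ⟨q.coeff n, hq n⟩ := by
    intro n
    simp only [Polynomial.finsetSum_coeff, Polynomial.coeff_monomial, Finset.sum_ite_eq']
    split_ifs with h
    · rfl
    · simp only [Polynomial.notMem_support_iff.mp h]
      rfl
  refine ⟨⟨_, fun n => by rw [hc n, Unitization.fst_inr]⟩, Polynomial.ext fun n => ?_⟩
  rw [coeff_unitizationPolyMap_polyNU]
  simp only [hc, Unitization.snd_inr]

theorem coe_evAt (r : ℓ) (q : polyNU ℓ S) :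
    ((evAt r q : S) : R)
      = (unitizationPolyMap S (q : Polynomial (Unitization ℓ S))).eval (algebraMap ℓ R r) := by
  have h : (Unitization.lift (NonUnitalSubalgebraClass.subtype S) : Unitization ℓ S →ₐ[ℓ] R)
      (Polynomial.eval (algebraMap ℓ _ r) (q : Polynomial (Unitization ℓ S)))
        = (unitizationPolyMap S (q : Polynomial (Unitization ℓ S))).eval (algebraMap ℓ R r) := by
    have := Polynomial.eval₂_at_apply
      (Unitization.lift (NonUnitalSubalgebraClass.subtype S) :
        Unitization ℓ S →ₐ[ℓ] R).toRingHom (p := (q : Polynomial (Unitization ℓ S)))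
      (algebraMap ℓ _ r)
    rw [Polynomial.eval₂_eq_eval_map] at this
    simpa [unitizationPolyMap] using this.symm
  rw [← h, Unitization.lift_apply, NonUnitalAlgHom.toAlgHom_apply, fst_eval_polyNU, map_zero,
    zero_add]
  rfl

/-- Summing a function of the coefficients that is given on `S` by a ring homomorphism out of `R`
amounts to mapping the polynomial along that homomorphism. -/
theorem sum_polyNU_eq_map {R' : Type} [CommRing R'] (f : R →+* R') (q : polyNU ℓ S) :
    ((q : Polynomial (Unitization ℓ S)).sum fun n a =>
        Polynomial.C (f (a.snd : R)) * Polynomial.X ^ n)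
      = (unitizationPolyMap S (q : Polynomial (Unitization ℓ S))).map f := by
  ext n
  rw [Polynomial.coeff_map, coeff_unitizationPolyMap_polyNU, Polynomial.sum_def,
    Polynomial.finsetSum_coeff]
  simp only [Polynomial.coeff_C_mul_X_pow, Finset.sum_ite_eq]
  split_ifs with h
  · rfl
  · simp [Polynomial.notMem_support_iff.mp h]

/-- A homomorphism to `R[s]` whose values have all their coefficients in `S` factors
through `S[s]`. -/
noncomputable def polyNULift {A : Type} [NonUnitalRing A] [Module ℓ A]
    (φ : A →ₙₐ[ℓ] Polynomial R) (hφ : ∀ a n, (φ a).coeff n ∈ S) : A →ₙₐ[ℓ] polyNU ℓ S :=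
  have spec a := (exists_polyNU_unitizationPolyMap_eq S (hφ a)).choose_spec
  { toFun a := (exists_polyNU_unitizationPolyMap_eq S (hφ a)).choose
    map_add' a b := unitizationPolyMap_injective_polyNU S <| (spec (a + b)).trans <| by
      rw [NonUnitalSubalgebra.coe_add, map_add, map_add, spec a, spec b]
    map_mul' a b := unitizationPolyMap_injective_polyNU S <| (spec (a * b)).trans <| by
      rw [NonUnitalSubalgebra.coe_mul, map_mul, map_mul, spec a, spec b]
    map_zero' := unitizationPolyMap_injective_polyNU S <| (spec 0).trans <| by
      rw [NonUnitalSubalgebra.coe_zero, map_zero, map_zero]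
    map_smul' c a := unitizationPolyMap_injective_polyNU S <| (spec (c • a)).trans <| by
      rw [NonUnitalSubalgebra.coe_smul, map_smul, map_smul, MonoidHom.id_apply, spec a] }

theorem unitizationPolyMap_polyNULift {A : Type} [NonUnitalRing A] [Module ℓ A]
    (φ : A →ₙₐ[ℓ] Polynomial R) (hφ : ∀ a n, (φ a).coeff n ∈ S) (a : A) :
    unitizationPolyMap S (polyNULift S φ hφ a : Polynomial (Unitization ℓ S)) = φ a :=
  (exists_polyNU_unitizationPolyMap_eq S (hφ a)).choose_spec

end CoefficientsInSubalgebra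

section RotationHomotopy

/-- The element `(t(1−s), 1−s(1−t))` of `(ℓ[t] × ℓ[t])[s]`. -/
noncomputable def homotopyPoint : Polynomial (Polynomial ℓ × Polynomial ℓ) :=
  Polynomial.C (X, 1) - Polynomial.C (X, 1 - X) * X

variable {ℓ}

theorem map_aeval_homotopyPoint {R' : Type} [CommRing R'] [Algebra ℓ R']
    (f : Polynomial ℓ × Polynomial ℓ →ₐ[ℓ] R') (p : Polynomial ℓ) :
    (aeval (homotopyPoint ℓ) p).map (f : Polynomial ℓ × Polynomial ℓ →+* R')
      = aeval (Polynomial.C (f (X, 1)) - Polynomial.C (f (X, 1 - X)) * X) p := by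
  have h := (Polynomial.aeval_algHom_apply (Polynomial.mapAlgHom f) (homotopyPoint ℓ) p).symm
  simpa [homotopyPoint] using h

theorem coeff_aeval_homotopyPoint_mem {p : Polynomial ℓ} (hp : p ∈ Omega0 ℓ) (n : ℕ) :
    (aeval (homotopyPoint ℓ) p).coeff n ∈ Omega1 ℓ := by
  obtain ⟨h0, h1⟩ := Omega0.eval_eq_zero hp
  have key : ∀ f : Polynomial ℓ × Polynomial ℓ →ₐ[ℓ] ℓ,
      f ((aeval (homotopyPoint ℓ) p).coeff n)
        = (aeval (Polynomial.C (f (X, 1)) - Polynomial.C (f (X, 1 - X)) * X) p).coeff n :=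
    fun f => by rw [← map_aeval_homotopyPoint, Polynomial.coeff_map]; rfl
  have kfst := fun r : ℓ => key ((aeval r).comp (AlgHom.fst ℓ _ _))
  have ksnd := fun r : ℓ => key ((aeval r).comp (AlgHom.snd ℓ _ _))
  simp only [AlgHom.comp_apply, AlgHom.fst_apply, AlgHom.snd_apply, aeval_X, map_one, map_sub,
    Polynomial.coe_aeval_eq_eval] at kfst ksnd
  have hz : aeval (0 : Polynomial ℓ) p = 0 := by
    rw [← map_zero (algebraMap ℓ (Polynomial ℓ)), aeval_algebraMap_apply_eq_algebraMap_eval, h0,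
      map_zero]
  have ho : aeval (1 : Polynomial ℓ) p = 0 := by
    rw [← map_one (algebraMap ℓ (Polynomial ℓ)), aeval_algebraMap_apply_eq_algebraMap_eval, h1,
      map_zero]
  refine ⟨?_, ?_, ?_⟩
  · rw [kfst, ksnd]; simp
  · rw [kfst]; simp [hz]
  · rw [ksnd]; simp [ho]

variable (ℓ) in
/-- The homomorphism `H : Ω₀ → Ω₁[s]`, `H(p) = (p(t(1−s)), p(1−s(1−t)))`. -/
noncomputable def rotationHomotopy : Omega0 ℓ →ₙₐ[ℓ] polyNU ℓ (Omega1 ℓ) :=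
  polyNULift (Omega1 ℓ)
    (((aeval (homotopyPoint ℓ) : Polynomial ℓ →ₐ[ℓ] Polynomial (Polynomial ℓ × Polynomial ℓ)) :
      Polynomial ℓ →ₙₐ[ℓ] Polynomial (Polynomial ℓ × Polynomial ℓ)).comp
      (NonUnitalSubalgebraClass.subtype (Omega0 ℓ)))
    fun p n => coeff_aeval_homotopyPoint_mem p.2 n

theorem unitizationPolyMap_rotationHomotopy (p : Omega0 ℓ) :
    unitizationPolyMap (Omega1 ℓ)
        (rotationHomotopy ℓ p : Polynomial (Unitization ℓ (Omega1 ℓ)))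
      = aeval (homotopyPoint ℓ) (p : Polynomial ℓ) :=
  unitizationPolyMap_polyNULift _ _ _ p

theorem coe_evAt_rotationHomotopy (r : ℓ) (p : Omega0 ℓ) :
    ((evAt r (rotationHomotopy ℓ p) : Omega1 ℓ) : Polynomial ℓ × Polynomial ℓ)
      = (aeval (X - X * Polynomial.C r) (p : Polynomial ℓ),
          aeval (1 - (1 - X) * Polynomial.C r) (p : Polynomial ℓ)) := by
  rw [coe_evAt, unitizationPolyMap_rotationHomotopy, ← Polynomial.coe_aeval_eq_eval]
  have h := Polynomial.aeval_algHom_apply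
    ((aeval (algebraMap ℓ (Polynomial ℓ × Polynomial ℓ) r) :
      Polynomial (Polynomial ℓ × Polynomial ℓ) →ₐ[Polynomial ℓ × Polynomial ℓ] _).restrictScalars
        ℓ) (homotopyPoint ℓ) (p : Polynomial ℓ)
  have hx : ((aeval (algebraMap ℓ (Polynomial ℓ × Polynomial ℓ) r) :
      Polynomial (Polynomial ℓ × Polynomial ℓ) →ₐ[Polynomial ℓ × Polynomial ℓ] _).restrictScalars
        ℓ) (homotopyPoint ℓ) = (X - X * Polynomial.C r, 1 - (1 - X) * Polynomial.C r) := by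
    ext1 <;> simp [homotopyPoint]
  rw [hx] at h
  refine h.symm.trans (Prod.ext ?_ ?_)
  · exact (Polynomial.aeval_algHom_apply (AlgHom.fst ℓ _ _) _ _).symm
  · exact (Polynomial.aeval_algHom_apply (AlgHom.snd ℓ _ _) _ _).symm

theorem evAt_zero_comp_rotationHomotopy :
    (evAt 0).comp (rotationHomotopy ℓ) = betaMap ℓ := by
  ext1 p
  refine Subtype.ext ((coe_evAt_rotationHomotopy 0 p).trans (Prod.ext ?_ ?_))
  · simp [betaMap]
  · have h := aeval_algebraMap_apply_eq_algebraMap_eval (A := Polynomial ℓ) 1 (p : Polynomial ℓ)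
    rw [(Omega0.eval_eq_zero p.2).2, map_one, map_zero] at h
    simpa [betaMap] using h

theorem evAt_one_comp_rotationHomotopy :
    (evAt 1).comp (rotationHomotopy ℓ) = betaTildeMap ℓ := by
  ext1 p
  refine Subtype.ext ((coe_evAt_rotationHomotopy 1 p).trans (Prod.ext ?_ ?_))
  · have h := aeval_algebraMap_apply_eq_algebraMap_eval (A := Polynomial ℓ) 0 (p : Polynomial ℓ)
    rw [(Omega0.eval_eq_zero p.2).1, map_zero] at h
    simpa [betaTildeMap] using h
  · simp [betaTildeMap]

end RotationHomotopy

/-- The map `H : Ω₀ → Ω₁[s]`, `H(p) = (p(t(1−s)), p(1−s(1−t)))`, is a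
well-defined homomorphism of `ℓ`-algebras and an elementary homotopy from `β` to `β̃`;
in particular `β` and `β̃` are polynomially homotopic.   (The formula for `H` is expressed by
applying, in each of the two components, the canonical embedding of `Ω₁[s]`-elements into
`ℓ[t][s]` which sends `∑ ωₙ sⁿ` to `∑ ωₙ sⁿ`.) -/
theorem stmt4 :
    (∃ H : Omega0 ℓ →ₙₐ[ℓ] polyNU ℓ (Omega1 ℓ),
      (∀ p : Omega0 ℓ,
        ((H p : Polynomial (Unitization ℓ (Omega1 ℓ))).sum fun n a =>
            Polynomial.C (((a.snd : Omega1 ℓ) : Polynomial ℓ × Polynomial ℓ).1) *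
              Polynomial.X ^ n)
          = Polynomial.aeval (Polynomial.C Polynomial.X * (1 - Polynomial.X))
              (p : Polynomial ℓ) ∧
        ((H p : Polynomial (Unitization ℓ (Omega1 ℓ))).sum fun n a =>
            Polynomial.C (((a.snd : Omega1 ℓ) : Polynomial ℓ × Polynomial ℓ).2) *
              Polynomial.X ^ n)
          = Polynomial.aeval (1 - Polynomial.X * (1 - Polynomial.C Polynomial.X))
              (p : Polynomial ℓ)) ∧
      (evAt 0).comp H = betaMap ℓ ∧ (evAt 1).comp H = betaTildeMap ℓ) ∧
    Homotopic (betaMap ℓ) (betaTildeMap ℓ) := by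
  refine ⟨⟨rotationHomotopy ℓ, fun p => ⟨?_, ?_⟩, evAt_zero_comp_rotationHomotopy,
    evAt_one_comp_rotationHomotopy⟩,
    .rel _ _ ⟨rotationHomotopy ℓ, evAt_zero_comp_rotationHomotopy,
      evAt_one_comp_rotationHomotopy⟩⟩
  · refine (sum_polyNU_eq_map (Omega1 ℓ) (AlgHom.fst ℓ (Polynomial ℓ) (Polynomial ℓ) :
      Polynomial ℓ × Polynomial ℓ →+* Polynomial ℓ) (rotationHomotopy ℓ p)).trans ?_
    rw [unitizationPolyMap_rotationHomotopy, map_aeval_homotopyPoint]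
    exact congrArg (fun x => aeval x (p : Polynomial ℓ)) (by simp only [AlgHom.fst_apply]; ring)
  · refine (sum_polyNU_eq_map (Omega1 ℓ) (AlgHom.snd ℓ (Polynomial ℓ) (Polynomial ℓ) :
      Polynomial ℓ × Polynomial ℓ →+* Polynomial ℓ) (rotationHomotopy ℓ p)).trans ?_
    rw [unitizationPolyMap_rotationHomotopy, map_aeval_homotopyPoint]
    exact congrArg (fun x => aeval x (p : Polynomial ℓ))
      (by simp only [AlgHom.snd_apply, map_sub, map_one]; ring)
end
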